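/- Let W₁ : (ℂ∖{0})² → ℂ be defined by W₁(z₁,z₂) = e^{−1}·(z₁ + z₂ + z₁^{−1}z₂^{−1} + z₂^{−1}), and let its critical values be the values of W₁ at its critical points. Then W₁ has exactly four critical values, they are pairwise distinct, and they consist of: one critical value λ₁ which is a positive real number, one critical value λ₃ which is a negative real number, and two critical values λ₀, λ₂ which are non-real and complex conjugate to each other. In particular, each critical value is attained at a unique critical point. -/

import Mathlib

/-- The Hori–Vafa superpotential of the Hirzebruch surface `𝔽₁` with anticanonical
Kähler parameters: `W₁(z₁,z₂) = e^{−1}(z₁ + z₂ + z₁⁻¹z₂⁻¹ + z₂⁻¹)`, regarded as a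
function on `ℂ × ℂ` (its restriction to `(ℂ∖{0})²` is the superpotential). -/
noncomputable def horiVafaW1 (p : ℂ × ℂ) : ℂ :=
  Complex.exp (-1) * (p.1 + p.2 + p.1⁻¹ * p.2⁻¹ + p.2⁻¹)

/-- The critical locus of `W₁` in `(ℂ∖{0})²`: both complex partial derivatives
vanish. -/
def horiVafaW1Crit : Set (ℂ × ℂ) :=
  {p : ℂ × ℂ | p.1 ≠ 0 ∧ p.2 ≠ 0 ∧
    deriv (fun w => horiVafaW1 (w, p.2)) p.1 = 0 ∧
    deriv (fun w => horiVafaW1 (p.1, w)) p.2 = 0}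

theorem hasDerivAt_horiVafaW1_fst {z₁ : ℂ} (z₂ : ℂ) (h₁ : z₁ ≠ 0) :
    HasDerivAt (fun w => horiVafaW1 (w, z₂))
      (Complex.exp (-1) * (1 - (z₁ ^ 2)⁻¹ * z₂⁻¹)) z₁ := by
  have h := ((((hasDerivAt_id z₁).add_const z₂).add
    ((hasDerivAt_inv h₁).mul_const z₂⁻¹)).add_const z₂⁻¹).const_mul (Complex.exp (-1))
  exact h.congr_deriv (by ring)

theorem hasDerivAt_horiVafaW1_snd (z₁ : ℂ) {z₂ : ℂ} (h₂ : z₂ ≠ 0) :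
    HasDerivAt (fun w => horiVafaW1 (z₁, w))
      (Complex.exp (-1) * (1 - (z₁⁻¹ + 1) * (z₂ ^ 2)⁻¹)) z₂ := by
  have h := ((((hasDerivAt_id z₂).const_add z₁).add
    ((hasDerivAt_inv h₂).const_mul z₁⁻¹)).add (hasDerivAt_inv h₂)).const_mul (Complex.exp (-1))
  exact h.congr_deriv (by ring)

theorem ne_zero_of_pow_four_eq {u : ℂ} (hu : u ^ 4 = u + 1) : u ≠ 0 := by
  rintro rfl
  norm_num at hu

/-- The critical points are parametrized by `u = z₁⁻¹`, a root of `u⁴ = u + 1`. -/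
theorem mem_horiVafaW1Crit_iff {p : ℂ × ℂ} :
    p ∈ horiVafaW1Crit ↔ ∃ u : ℂ, u ^ 4 = u + 1 ∧ p = (u⁻¹, u ^ 2) := by
  obtain ⟨z₁, z₂⟩ := p
  constructor
  · rintro ⟨h₁, h₂, hd₁, hd₂⟩
    dsimp only at h₁ h₂ hd₁ hd₂
    rw [(hasDerivAt_horiVafaW1_fst z₂ h₁).deriv] at hd₁
    rw [(hasDerivAt_horiVafaW1_snd z₁ h₂).deriv] at hd₂
    have e₁ := (mul_eq_zero.mp hd₁).resolve_left (Complex.exp_ne_zero _)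
    have e₂ := (mul_eq_zero.mp hd₂).resolve_left (Complex.exp_ne_zero _)
    have hz : z₂ = z₁⁻¹ ^ 2 := by
      field_simp at e₁ ⊢
      linear_combination e₁
    refine ⟨z₁⁻¹, ?_, by rw [inv_inv, hz]⟩
    have h : z₂ ^ 2 = z₁⁻¹ + 1 := by
      have h' : (z₁⁻¹ + 1) * ((z₂ ^ 2)⁻¹ * z₂ ^ 2) = z₁⁻¹ + 1 := by
        rw [inv_mul_cancel₀ (pow_ne_zero 2 h₂), mul_one]
      linear_combination z₂ ^ 2 * e₂ + h'
    rw [← h, hz]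
    ring
  · rintro ⟨u, hu, h⟩
    obtain ⟨rfl, rfl⟩ := Prod.mk.inj h
    have hu₀ := ne_zero_of_pow_four_eq hu
    refine ⟨inv_ne_zero hu₀, pow_ne_zero 2 hu₀, ?_, ?_⟩
    · rw [(hasDerivAt_horiVafaW1_fst _ (inv_ne_zero hu₀)).deriv]
      field_simp
      ring
    · rw [(hasDerivAt_horiVafaW1_snd _ (pow_ne_zero 2 hu₀)).deriv, inv_inv, ← hu, ← pow_mul,
        mul_inv_cancel₀ (pow_ne_zero _ hu₀), sub_self, mul_zero]

theorem horiVafaW1_apply_of_pow_four_eq {u : ℂ} (hu : u ^ 4 = u + 1) :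
    horiVafaW1 (u⁻¹, u ^ 2) = (Real.exp (-1) : ℂ) * (u ^ 3 + 2 * u ^ 2 - 1) := by
  have hu₀ := ne_zero_of_pow_four_eq hu
  have hi : u⁻¹ = u ^ 3 - 1 := by
    field_simp
    linear_combination -hu
  have hi₂ : (u ^ 2)⁻¹ = u ^ 2 - u ^ 3 + 1 := by
    rw [← inv_pow, hi]
    linear_combination u ^ 2 * hu
  simp only [horiVafaW1, inv_inv, hi₂]
  rw [hi]
  push_cast
  linear_combination -Complex.exp (-1) * hu

theorem exists_roots_pow_four_eq :
    ∃ (a b : ℝ) (z : ℂ), 0 < a ∧ a ^ 4 = a + 1 ∧ -1 < b ∧ b < 0 ∧ b ^ 4 = b + 1 ∧ z.im ≠ 0 ∧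
      ∀ u : ℂ, u ^ 4 = u + 1 ↔ u = z ∨ u = a ∨ u = (starRingEnd ℂ) z ∨ u = b := by
  have hc : Continuous fun x : ℝ => x ^ 4 - x - 1 := by fun_prop
  obtain ⟨a, ⟨ha₁, -⟩, ha⟩ := intermediate_value_Ioo (by norm_num : (1 : ℝ) ≤ 2) hc.continuousOn
    (by norm_num : (0 : ℝ) ∈ _)
  obtain ⟨b, ⟨hb₁, hb₀⟩, hb⟩ := intermediate_value_Ioo' (by norm_num : (-1 : ℝ) ≤ 0)
    hc.continuousOn (by norm_num : (0 : ℝ) ∈ _)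
  dsimp only at ha hb
  have hab : (a + b) * (a ^ 2 + b ^ 2) = 1 := by
    apply mul_left_cancel₀ (sub_ne_zero.mpr (hb₀.trans (zero_lt_one.trans ha₁)).ne')
    linear_combination ha - hb
  have hp : a * b * (a ^ 2 + a * b + b ^ 2) = -1 := by
    linear_combination a * hab - ha
  have hd : 0 < 3 * (a + b) ^ 2 - 4 * (a * b) := by
    nlinarith [sq_nonneg (a + b), mul_pos (zero_lt_one.trans ha₁) (neg_pos.mpr hb₀)]
  set d := Real.sqrt (3 * (a + b) ^ 2 - 4 * (a * b))
  have hd₀ : 0 < d := Real.sqrt_pos.mpr hd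
  have hdd : (d : ℂ) ^ 2 = 3 * (a + b) ^ 2 - 4 * (a * b) := by
    exact_mod_cast Real.sq_sqrt hd.le
  have hab' : ((a : ℂ) + b) * (a ^ 2 + b ^ 2) = 1 := by exact_mod_cast hab
  have hp' : (a : ℂ) * b * (a ^ 2 + a * b + b ^ 2) = -1 := by exact_mod_cast hp
  have hconj : (starRingEnd ℂ) (-((a : ℂ) + b) / 2 + d / 2 * Complex.I) =
      -((a : ℂ) + b) / 2 - d / 2 * Complex.I := by
    simp only [map_add, map_mul, map_div₀, map_neg, Complex.conj_ofReal, Complex.conj_ofNat,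
      Complex.conj_I]
    ring
  refine ⟨a, b, -((a : ℂ) + b) / 2 + d / 2 * Complex.I, by linarith, by linarith, hb₁, hb₀,
    by linarith, ?_, fun u => ?_⟩
  · simp [hd₀.ne']
  rw [hconj]
  have key : u ^ 4 - (u + 1) = (u - (-((a : ℂ) + b) / 2 + d / 2 * Complex.I)) *
      ((u - a) * ((u - (-((a : ℂ) + b) / 2 - d / 2 * Complex.I)) * (u - b))) := by
    linear_combination u * hab' - hp' - (u - a) * (u - b) / 4 * hdd
      + (u - a) * (u - b) * (d : ℂ) ^ 2 / 4 * Complex.I_sq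
  rw [← sub_eq_zero, key]
  simp only [mul_eq_zero, sub_eq_zero]

theorem im_cubic_ne_zero {z : ℂ} (hz : z ^ 4 = z + 1) (him : z.im ≠ 0) :
    (z ^ 3 + 2 * z ^ 2 - 1).im ≠ 0 := by
  obtain ⟨x, y⟩ := z
  dsimp only at him
  have hre := congrArg Complex.re hz
  have himz := congrArg Complex.im hz
  simp only [pow_succ, pow_zero, one_mul, Complex.mul_re, Complex.mul_im, Complex.add_re,
    Complex.add_im, Complex.one_re, Complex.one_im] at hre himz
  intro h
  simp [pow_succ] at h
  have h₁ : y ^ 2 = 3 * x ^ 2 + 4 * x := by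
    apply mul_left_cancel₀ him
    linear_combination -h
  have h₂ : 4 * x ^ 3 - 4 * x * y ^ 2 = 1 := by
    apply mul_left_cancel₀ him
    linear_combination himz
  have h₃ : x ^ 4 - 6 * x ^ 2 * y ^ 2 + (y ^ 2) ^ 2 = x + 1 := by
    linear_combination hre
  rw [h₁] at h₂ h₃
  nlinarith [sq_nonneg x]

/-- `W₁` has exactly four pairwise distinct critical values: a positive real `λ₁`, a
negative real `λ₃`, and two non-real, mutually conjugate values `λ₀, λ₂`; moreover,
each critical value is attained at a unique critical point. -/
theorem horiVafaW1_critValues :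
    ∃ l₀ l₁ l₂ l₃ : ℂ,
      horiVafaW1 '' horiVafaW1Crit = {l₀, l₁, l₂, l₃} ∧
      (l₀ ≠ l₁ ∧ l₀ ≠ l₂ ∧ l₀ ≠ l₃ ∧ l₁ ≠ l₂ ∧ l₁ ≠ l₃ ∧ l₂ ≠ l₃) ∧
      (l₁.im = 0 ∧ 0 < l₁.re) ∧
      (l₃.im = 0 ∧ l₃.re < 0) ∧
      (l₀.im ≠ 0 ∧ l₂ = (starRingEnd ℂ) l₀) ∧
      ∀ v ∈ horiVafaW1 '' horiVafaW1Crit,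
        ∃! p : ℂ × ℂ, p ∈ horiVafaW1Crit ∧ horiVafaW1 p = v := by
  obtain ⟨a, b, z, ha, ha₄, hb₁, hb₀, hb₄, hz, hroots⟩ := exists_roots_pow_four_eq
  set g : ℂ → ℂ := fun u => (Real.exp (-1) : ℂ) * (u ^ 3 + 2 * u ^ 2 - 1) with hg
  have he : 0 < Real.exp (-1) := Real.exp_pos _
  have hcrit : ∀ v : ℂ, v ∈ horiVafaW1 '' horiVafaW1Crit ↔ ∃ u : ℂ, u ^ 4 = u + 1 ∧ g u = v := by
    intro v
    constructor
    · rintro ⟨p, hp, rfl⟩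
      obtain ⟨u, hu, rfl⟩ := mem_horiVafaW1Crit_iff.mp hp
      exact ⟨u, hu, (horiVafaW1_apply_of_pow_four_eq hu).symm⟩
    · rintro ⟨u, hu, rfl⟩
      exact ⟨_, mem_horiVafaW1Crit_iff.mpr ⟨u, hu, rfl⟩, horiVafaW1_apply_of_pow_four_eq hu⟩
  have hreal : ∀ x : ℝ, g x = ((Real.exp (-1) * (x ^ 3 + 2 * x ^ 2 - 1) : ℝ) : ℂ) := by
    intro x
    simp [hg]
  have hgconj : g ((starRingEnd ℂ) z) = (starRingEnd ℂ) (g z) := by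
    simp only [hg, map_mul, map_sub, map_add, map_pow, map_one, Complex.conj_ofReal,
      Complex.conj_ofNat]
  have hz₀ : (g z).im ≠ 0 := by
    rw [hg, Complex.im_ofReal_mul]
    exact mul_ne_zero he.ne' (im_cubic_ne_zero ((hroots z).mpr (Or.inl rfl)) hz)
  have hz₂ : (g ((starRingEnd ℂ) z)).im = -(g z).im := by rw [hgconj, Complex.conj_im]
  have ha_im : (g a).im = 0 := by rw [hreal, Complex.ofReal_im]
  have hb_im : (g b).im = 0 := by rw [hreal, Complex.ofReal_im]
  have ha_re : 0 < (g a).re := by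
    rw [hreal, Complex.ofReal_re]
    have h : 1 < a := by
      by_contra! h
      nlinarith [pow_le_one₀ ha.le h (n := 4)]
    exact mul_pos he (by nlinarith [pow_pos ha 3])
  have hb_re : (g b).re < 0 := by
    rw [hreal, Complex.ofReal_re]
    refine mul_neg_of_pos_of_neg he ?_
    have h : b ^ 3 + 2 * b ^ 2 - 1 = (b + 1) * (b * (b + 1) - 1) := by ring
    rw [h]
    exact mul_neg_of_pos_of_neg (by linarith) (by nlinarith)
  have h₀₁ : g z ≠ g a := fun h => hz₀ (by rw [h, ha_im])
  have h₀₂ : g z ≠ g ((starRingEnd ℂ) z) := fun h => hz₀ (by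
    rw [← h] at hz₂
    linarith)
  have h₀₃ : g z ≠ g b := fun h => hz₀ (by rw [h, hb_im])
  have h₁₂ : g a ≠ g ((starRingEnd ℂ) z) := fun h => hz₀ (by
    rw [← h, ha_im] at hz₂
    linarith)
  have h₁₃ : g a ≠ g b := fun h => by
    rw [h] at ha_re
    linarith
  have h₂₃ : g ((starRingEnd ℂ) z) ≠ g b := fun h => hz₀ (by
    rw [h, hb_im] at hz₂
    linarith)
  refine ⟨g z, g a, g ((starRingEnd ℂ) z), g b, ?_, ⟨h₀₁, h₀₂, h₀₃, h₁₂, h₁₃, h₂₃⟩,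
    ⟨ha_im, ha_re⟩, ⟨hb_im, hb_re⟩, ⟨hz₀, hgconj⟩, ?_⟩
  · ext v
    simp only [hcrit, hroots, or_and_right, exists_or, exists_eq_left, Set.mem_insert_iff,
      Set.mem_singleton_iff, eq_comm (a := v)]
  · have hinj : ∀ u w : ℂ, u ^ 4 = u + 1 → w ^ 4 = w + 1 → g u = g w → u = w := by
      intro u w hu hw h
      rcases (hroots u).mp hu with rfl | rfl | rfl | rfl <;>
      rcases (hroots w).mp hw with rfl | rfl | rfl | rfl <;>
      first
        | rfl
        | exact absurd h ‹_›
        | exact absurd h.symm ‹_›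
    intro v hv
    obtain ⟨u, hu, rfl⟩ := (hcrit v).mp hv
    refine ⟨(u⁻¹, u ^ 2), ⟨mem_horiVafaW1Crit_iff.mpr ⟨u, hu, rfl⟩,
      horiVafaW1_apply_of_pow_four_eq hu⟩, ?_⟩
    rintro p ⟨hp, hpv⟩
    obtain ⟨w, hw, rfl⟩ := mem_horiVafaW1Crit_iff.mp hp
    rw [horiVafaW1_apply_of_pow_four_eq hw] at hpv
    rw [hinj w u hw hu hpv]
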